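/- Let G be a finite group, N a normal subgroup of G, F an arbitrary field whose characteristic does not divide |A(G) ∩ N|, and k ≥ 1. Then S(G) ∩ N is k-generated as a normal subgroup of G if and only if there exists an F[G]-module V that is a direct sum of k simple F[G]-modules and whose restriction to N is faithful (the only element of N acting as the identity on V is 1). -/

import Mathlib

variable {G : Type*} [Group G]

/-- A minimal normal subgroup of a group `G`: a nontrivial normal subgroup that is
minimal among the nontrivial normal subgroups of `G`. -/
def IsMinimalNormal (M : Subgroup G) : Prop :=
  M.Normal ∧ M ≠ ⊥ ∧ ∀ K : Subgroup G, K.Normal → K ≠ ⊥ → K ≤ M → K = M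

/-- `A(G)`: the subgroup generated by all abelian minimal normal subgroups of `G`. -/
def aSocle (G : Type*) [Group G] : Subgroup G :=
  sSup {M : Subgroup G | IsMinimalNormal M ∧ ∀ x ∈ M, ∀ y ∈ M, x * y = y * x}

/-- The socle `S(G)`: the subgroup generated by all minimal normal subgroups of `G`. -/
def socle (G : Type*) [Group G] : Subgroup G :=
  sSup {M : Subgroup G | IsMinimalNormal M}

/-- `H` is generated by `k` (not necessarily distinct) elements as a normal subgroup of
`G`: there are `k` elements of `H` whose normal closure in `G` is `H`. -/
def NormallyKGenerated (H : Subgroup G) (k : ℕ) : Prop :=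
  ∃ f : Fin k → G, (∀ i, f i ∈ H) ∧ Subgroup.normalClosure (Set.range f) = H


section ModuleDuality

/-- Induction principle for finite semisimple modules. -/
theorem finite_semisimple_induction {R : Type} [Ring R]
    (P : ∀ (M : Type) [AddCommGroup M] [Module R M], Prop)
    (hiso : ∀ (M M' : Type) [AddCommGroup M] [Module R M] [AddCommGroup M'] [Module R M'],
      (M ≃ₗ[R] M') → P M → P M')
    (hzero : ∀ (M : Type) [AddCommGroup M] [Module R M] [Subsingleton M], P M)
    (hstep : ∀ (Y S : Type) [AddCommGroup Y] [Module R Y] [AddCommGroup S] [Module R S]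
      [Finite Y] [Finite S] [IsSemisimpleModule R Y] [IsSimpleModule R S], P Y → P (Y × S))
    (M : Type) [AddCommGroup M] [Module R M] [Finite M] [IsSemisimpleModule R M] : P M := by
  induction hn : Nat.card M using Nat.strong_induction_on generalizing M with
  | _ n ih =>
    rcases subsingleton_or_nontrivial M with h | h
    · exact hzero M
    · obtain ⟨S, hS⟩ := IsSemisimpleModule.exists_simple_submodule R M
      obtain ⟨Y, hY⟩ := exists_isCompl S
      have e : (Y × S) ≃ₗ[R] M := Submodule.prodEquivOfIsCompl Y S hY.symm
      have hSn : Nontrivial S := IsSimpleModule.nontrivial R S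
      have hc : Nat.card Y < n := by
        rw [← hn, ← Nat.card_congr e.toEquiv, Nat.card_prod]
        have h1 : 1 < Nat.card S := Finite.one_lt_card
        have h2 : 0 < Nat.card Y := Nat.card_pos
        nlinarith
      exact hiso _ _ e (hstep Y S (ih _ hc Y rfl))

theorem card_hom_symm {R : Type} [Ring R] (S : Type) [AddCommGroup S] [Module R S]
    [IsSimpleModule R S] (M : Type) [AddCommGroup M] [Module R M] [Finite M]
    [IsSemisimpleModule R M] : Nat.card (M →ₗ[R] S) = Nat.card (S →ₗ[R] M) := by
  refine finite_semisimple_induction (R := R) (M := M)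
    (P := fun M _ _ => Nat.card (M →ₗ[R] S) = Nat.card (S →ₗ[R] M)) ?_ ?_ ?_
  · intro M M' _ _ _ _ e h
    have e1 : (M →ₗ[R] S) ≃ (M' →ₗ[R] S) :=
      { toFun := fun f => f ∘ₗ e.symm.toLinearMap
        invFun := fun f => f ∘ₗ e.toLinearMap
        left_inv := fun f => by ext; simp
        right_inv := fun f => by ext; simp }
    have e2 : (S →ₗ[R] M) ≃ (S →ₗ[R] M') :=
      { toFun := fun f => e.toLinearMap ∘ₗ f
        invFun := fun f => e.symm.toLinearMap ∘ₗ f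
        left_inv := fun f => by ext; simp
        right_inv := fun f => by ext; simp }
    rw [← Nat.card_congr e1, ← Nat.card_congr e2, h]
  · intro M _ _ _
    have : Subsingleton (M →ₗ[R] S) := ⟨fun f g => by
      ext x; rw [Subsingleton.elim x 0]; simp⟩
    have : Subsingleton (S →ₗ[R] M) := ⟨fun f g => by
      ext x; exact Subsingleton.elim _ _⟩
    simp
  · intro Y S' _ _ _ _ _ _ _ _ h
    rw [← Nat.card_congr (LinearMap.coprodEquiv ℕ : ((Y →ₗ[R] S) × (S' →ₗ[R] S)) ≃ₗ[ℕ] _).toEquiv,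
      ← Nat.card_congr (LinearMap.prodEquiv ℕ : ((S →ₗ[R] Y) × (S →ₗ[R] S')) ≃ₗ[ℕ] _).toEquiv,
      Nat.card_prod, Nat.card_prod, h]
    congr 1
    by_cases hne : Nonempty (S ≃ₗ[R] S')
    · obtain ⟨e⟩ := hne
      exact Nat.card_congr
        { toFun := fun f => e.toLinearMap ∘ₗ f ∘ₗ e.toLinearMap
          invFun := fun f => e.symm.toLinearMap ∘ₗ f ∘ₗ e.symm.toLinearMap
          left_inv := fun f => by ext; simp
          right_inv := fun f => by ext; simp }
    · have : Subsingleton (S' →ₗ[R] S) := by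
        refine ⟨fun f g => ?_⟩
        have : ∀ f : S' →ₗ[R] S, f = 0 := fun f => by
          by_contra hf
          exact hne ⟨(LinearEquiv.ofBijective f (LinearMap.bijective_of_ne_zero hf)).symm⟩
        rw [this f, this g]
      have : Subsingleton (S →ₗ[R] S') := by
        refine ⟨fun f g => ?_⟩
        have : ∀ f : S →ₗ[R] S', f = 0 := fun f => by
          by_contra hf
          exact hne ⟨(LinearEquiv.ofBijective f (LinearMap.bijective_of_ne_zero hf))⟩
        rw [this f, this g]
      simp

theorem finite_linearMap {R : Type} [Ring R] (M S : Type) [AddCommGroup M] [Module R M]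
    [AddCommGroup S] [Module R S] [Finite M] [Finite S] : Finite (M →ₗ[R] S) :=
  Finite.of_injective (fun f : M →ₗ[R] S => (f : M → S)) DFunLike.coe_injective

/-- Strict growth of the number of homs when adding a simple summand. -/
theorem card_hom_lt {R : Type} [Ring R] (Y S : Type) [AddCommGroup Y] [Module R Y]
    [AddCommGroup S] [Module R S] [Finite Y] [Finite S] [IsSimpleModule R S] :
    Nat.card (Y →ₗ[R] S) < Nat.card (Y × S →ₗ[R] S) := by
  have := finite_linearMap (R := R) Y S
  have := finite_linearMap (R := R) S S
  rw [← Nat.card_congr (LinearMap.coprodEquiv ℕ : ((Y →ₗ[R] S) × (S →ₗ[R] S)) ≃ₗ[ℕ] _).toEquiv,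
    Nat.card_prod]
  have hSn : Nontrivial S := IsSimpleModule.nontrivial R S
  have : Nontrivial (S →ₗ[R] S) := inferInstanceAs (Nontrivial (Module.End R S))
  have h1 : 1 < Nat.card (S →ₗ[R] S) := Finite.one_lt_card
  have h2 : 0 < Nat.card (Y →ₗ[R] S) := Nat.card_pos
  nlinarith

theorem card_hom_lt' {R : Type} [Ring R] (Y S : Type) [AddCommGroup Y] [Module R Y]
    [AddCommGroup S] [Module R S] [Finite Y] [Finite S] [IsSimpleModule R S] :
    Nat.card (S →ₗ[R] Y) < Nat.card (S →ₗ[R] Y × S) := by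
  have := finite_linearMap (R := R) S Y
  have := finite_linearMap (R := R) S S
  rw [← Nat.card_congr (LinearMap.prodEquiv ℕ : ((S →ₗ[R] Y) × (S →ₗ[R] S)) ≃ₗ[ℕ] _).toEquiv,
    Nat.card_prod]
  have hSn : Nontrivial S := IsSimpleModule.nontrivial R S
  have : Nontrivial (S →ₗ[R] S) := inferInstanceAs (Nontrivial (Module.End R S))
  have h1 : 1 < Nat.card (S →ₗ[R] S) := Finite.one_lt_card
  have h2 : 0 < Nat.card (S →ₗ[R] Y) := Nat.card_pos
  nlinarith

theorem gen_of_card_hom {R : Type} [Ring R] (k : ℕ) (M : Type) [AddCommGroup M] [Module R M]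
    [Finite M] [IsSemisimpleModule R M]
    (h : ∀ (S : Type) [AddCommGroup S] [Module R S] [Finite S] [IsSimpleModule R S],
      Nat.card (M →ₗ[R] S) ≤ Nat.card S ^ k) :
    ∃ x : Fin k → M, Submodule.span R (Set.range x) = ⊤ := by
  revert h
  refine finite_semisimple_induction (R := R) (M := M)
    (P := fun M _ _ => (∀ (S : Type) [AddCommGroup S] [Module R S] [Finite S]
      [IsSimpleModule R S], Nat.card (M →ₗ[R] S) ≤ Nat.card S ^ k) →
      ∃ x : Fin k → M, Submodule.span R (Set.range x) = ⊤) ?_ ?_ ?_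
  · intro M M' _ _ _ _ e ih h
    obtain ⟨x, hx⟩ := ih (fun S _ _ _ _ => by
      have e1 : (M →ₗ[R] S) ≃ (M' →ₗ[R] S) :=
        { toFun := fun f => f ∘ₗ e.symm.toLinearMap
          invFun := fun f => f ∘ₗ e.toLinearMap
          left_inv := fun f => by ext; simp
          right_inv := fun f => by ext; simp }
      rw [Nat.card_congr e1]; exact h S)
    refine ⟨e ∘ x, ?_⟩
    have := congrArg (Submodule.map e.toLinearMap) hx
    rw [Submodule.map_span, Submodule.map_top, ← Set.range_comp, LinearEquiv.range] at this
    exact this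
  · intro M _ _ _ _
    exact ⟨0, Subsingleton.elim _ _⟩
  · intro Y S _ _ _ _ _ _ _ _ ih h
    obtain ⟨y, hy⟩ := ih (fun S' _ _ _ _ => by
      have := finite_linearMap (R := R) (Y × S) S'
      refine le_trans ?_ (h S')
      refine Nat.card_le_card_of_injective (fun f => f ∘ₗ LinearMap.fst R Y S) ?_
      intro f g hfg
      ext v
      simpa using LinearMap.congr_fun hfg (v, 0))
    have hns : ¬ Function.Surjective (fun (f : Y →ₗ[R] S) (i : Fin k) => f (y i)) := by
      intro hs
      have := finite_linearMap (R := R) Y S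
      have h1 := Nat.card_le_card_of_surjective _ hs
      have h2 := card_hom_lt (R := R) Y S
      have h3 := h S
      rw [Nat.card_fun] at h1
      simp at h1
      omega
    simp only [Function.Surjective, not_forall, not_exists] at hns
    obtain ⟨s, hs⟩ := hns
    refine ⟨fun i => (y i, s i), ?_⟩
    set Z := Submodule.span R (Set.range (fun i => (y i, s i))) with hZ
    have hfst : ∀ v : Y, ∃ t : S, (v, t) ∈ Z := by
      intro v
      have h1 : Submodule.map (LinearMap.fst R Y S) Z = ⊤ := by
        rw [hZ, Submodule.map_span, ← Set.range_comp, ← hy]; rfl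
      have h2 : v ∈ Submodule.map (LinearMap.fst R Y S) Z := h1 ▸ Submodule.mem_top
      obtain ⟨⟨v', t⟩, ht, rfl⟩ := h2
      exact ⟨t, ht⟩
    rcases eq_bot_or_eq_top (Submodule.comap (LinearMap.inr R Y S) Z) with hb | ht
    · exfalso
      have hinj : Function.Injective ((LinearMap.fst R Y S) ∘ₗ Z.subtype) := by
        rw [← LinearMap.ker_eq_bot, LinearMap.ker_eq_bot']
        rintro ⟨⟨a, b⟩, hm⟩ h0
        simp at h0
        subst h0
        have : b ∈ Submodule.comap (LinearMap.inr R Y S) Z := hm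
        rw [hb, Submodule.mem_bot] at this
        subst this
        rfl
      have hsur : Function.Surjective ((LinearMap.fst R Y S) ∘ₗ Z.subtype) := by
        intro v
        obtain ⟨t, ht⟩ := hfst v
        exact ⟨⟨(v, t), ht⟩, rfl⟩
      let e := LinearEquiv.ofBijective _ ⟨hinj, hsur⟩
      apply hs ((LinearMap.snd R Y S) ∘ₗ Z.subtype ∘ₗ e.symm.toLinearMap)
      funext i
      have hm : (y i, s i) ∈ Z := Submodule.subset_span ⟨i, rfl⟩
      have : e.symm (y i) = ⟨(y i, s i), hm⟩ := by
        rw [LinearEquiv.symm_apply_eq]; rfl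
      simp [this]
    · rw [eq_top_iff]
      rintro ⟨v, t⟩ -
      obtain ⟨t', ht'⟩ := hfst v
      have h1 : t - t' ∈ Submodule.comap (LinearMap.inr R Y S) Z := ht ▸ Submodule.mem_top
      have h2 := Z.add_mem ht' h1
      simpa using h2

theorem cogen_of_card_hom {R : Type} [Ring R] (C : Type) [AddCommGroup C]
    (k : ℕ) (M : Type) [AddCommGroup M] [Module R M]
    [Finite M] [IsSemisimpleModule R M]
    (hC : ∀ (S : Type) [AddCommGroup S] [Module R S] [Finite S] [IsSimpleModule R S]
      (f : S →ₗ[R] M), Function.Injective f → Nat.card (S →+ C) = Nat.card S)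
    (h : ∀ (S : Type) [AddCommGroup S] [Module R S] [Finite S] [IsSimpleModule R S],
      Nat.card (S →ₗ[R] M) ≤ Nat.card S ^ k) :
    ∃ χ : Fin k → (M →+ C), ∀ Z : Submodule R M, (∀ i, ∀ z ∈ Z, χ i z = 0) → Z = ⊥ := by
  revert hC h
  refine finite_semisimple_induction (R := R) (M := M)
    (P := fun M _ _ =>
    (∀ (S : Type) [AddCommGroup S] [Module R S] [Finite S] [IsSimpleModule R S]
      (f : S →ₗ[R] M), Function.Injective f → Nat.card (S →+ C) = Nat.card S) →
    (∀ (S : Type) [AddCommGroup S] [Module R S] [Finite S] [IsSimpleModule R S],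
      Nat.card (S →ₗ[R] M) ≤ Nat.card S ^ k) →
    ∃ χ : Fin k → (M →+ C), ∀ Z : Submodule R M, (∀ i, ∀ z ∈ Z, χ i z = 0) → Z = ⊥) ?_ ?_ ?_
  · intro M M' _ _ _ _ e ih hC h
    obtain ⟨χ, hχ⟩ := ih (fun S _ _ _ _ f hf => hC S (e.toLinearMap ∘ₗ f) (by
        simpa using hf)) (fun S _ _ _ _ => by
      have e2 : (S →ₗ[R] M) ≃ (S →ₗ[R] M') :=
        { toFun := fun f => e.toLinearMap ∘ₗ f
          invFun := fun f => e.symm.toLinearMap ∘ₗ f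
          left_inv := fun f => by ext; simp
          right_inv := fun f => by ext; simp }
      rw [Nat.card_congr e2]; exact h S)
    refine ⟨fun i => (χ i).comp e.symm.toLinearMap.toAddMonoidHom, fun Z hZ => ?_⟩
    have := hχ (Z.comap e.toLinearMap) (fun i z hz => by simpa using hZ i _ hz)
    rw [eq_bot_iff]
    intro z hz
    have h1 : e.symm z ∈ Z.comap e.toLinearMap := by simpa using hz
    rw [this] at h1
    simpa using h1
  · intro M _ _ _ _ _
    exact ⟨0, fun _ _ => Subsingleton.elim _ _⟩
  · intro Y S _ _ _ _ _ _ _ _ ih hC h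
    obtain ⟨χ, hχ⟩ := ih (fun S' _ _ _ _ f hf =>
      hC S' (LinearMap.inl R Y S ∘ₗ f) (LinearMap.inl_injective.comp hf))
      (fun S' _ _ _ _ => by
      have := finite_linearMap (R := R) S' (Y × S)
      refine le_trans ?_ (h S')
      refine Nat.card_le_card_of_injective (fun f => LinearMap.inl R Y S ∘ₗ f) ?_
      intro f g hfg
      ext v
      simpa using LinearMap.congr_fun hfg v)
    have hcS : Nat.card (S →+ C) = Nat.card S := hC S (LinearMap.inr R Y S) LinearMap.inr_injective
    have hns : ¬ Function.Surjective
        (fun (f : S →ₗ[R] Y) (i : Fin k) => (χ i).comp f.toAddMonoidHom) := by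
      intro hs
      have := finite_linearMap (R := R) S Y
      have h1 := Nat.card_le_card_of_surjective _ hs
      have h2 := card_hom_lt' (R := R) Y S
      have h3 := h S
      rw [Nat.card_fun, hcS] at h1
      simp at h1
      omega
    simp only [Function.Surjective, not_forall, not_exists] at hns
    obtain ⟨l, hl⟩ := hns
    refine ⟨fun i => (χ i).coprod (-l i), fun Z hZ => ?_⟩
    have hinl : Z.comap (LinearMap.inl R Y S) = ⊥ := by
      apply hχ
      intro i z hz
      simpa using hZ i _ hz
    have hinl' : ∀ v : Y, (v, (0 : S)) ∈ Z → v = 0 := fun v hv => by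
      have : v ∈ Z.comap (LinearMap.inl R Y S) := hv
      rw [hinl] at this
      simpa using this
    rcases eq_bot_or_eq_top (Submodule.map (LinearMap.snd R Y S) Z) with hb | ht
    · rw [eq_bot_iff]
      rintro ⟨v, t⟩ hz
      have : t ∈ Submodule.map (LinearMap.snd R Y S) Z := ⟨_, hz, rfl⟩
      rw [hb, Submodule.mem_bot] at this
      subst this
      rw [hinl' v hz]; rfl
    · exfalso
      have hinj : Function.Injective ((LinearMap.snd R Y S) ∘ₗ Z.subtype) := by
        rw [← LinearMap.ker_eq_bot, LinearMap.ker_eq_bot']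
        rintro ⟨⟨a, b⟩, hm⟩ h0
        simp at h0
        subst h0
        have := hinl' _ hm
        subst this
        rfl
      have hsur : Function.Surjective ((LinearMap.snd R Y S) ∘ₗ Z.subtype) := by
        intro v
        have : v ∈ Submodule.map (LinearMap.snd R Y S) Z := ht ▸ Submodule.mem_top
        obtain ⟨z, hz, rfl⟩ := this
        exact ⟨⟨z, hz⟩, rfl⟩
      let e := LinearEquiv.ofBijective _ ⟨hinj, hsur⟩
      apply hl ((LinearMap.fst R Y S) ∘ₗ Z.subtype ∘ₗ e.symm.toLinearMap)
      funext i
      ext t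
      have h1 := hZ i (e.symm t) (e.symm t).2
      have h2 : ((e.symm t : Z) : Y × S).2 = t := e.apply_symm_apply t
      rw [AddMonoidHom.coprod_apply, h2] at h1
      simp only [AddMonoidHom.neg_apply] at h1
      rw [add_neg_eq_zero] at h1
      exact h1

theorem gen_iff_cogen {R : Type} [Ring R] (C : Type) [AddCommGroup C]
    (k : ℕ) (M : Type) [AddCommGroup M] [Module R M]
    [Finite M] [IsSemisimpleModule R M]
    (hC : ∀ (S : Type) [AddCommGroup S] [Module R S] [Finite S]
      (f : S →ₗ[R] M), Function.Injective f → Nat.card (S →+ C) = Nat.card S) :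
    (∃ x : Fin k → M, Submodule.span R (Set.range x) = ⊤) ↔
    ∃ χ : Fin k → (M →+ C), ∀ Z : Submodule R M, (∀ i, ∀ z ∈ Z, χ i z = 0) → Z = ⊥ := by
  constructor
  · rintro ⟨x, hx⟩
    apply cogen_of_card_hom C k M (fun S _ _ _ _ f hf => hC S f hf)
    intro S _ _ _ _
    rw [← card_hom_symm]
    have : Nat.card (Fin k → S) = Nat.card S ^ k := by rw [Nat.card_fun]; simp
    rw [← this]
    refine Nat.card_le_card_of_injective (fun (f : M →ₗ[R] S) i => f (x i)) ?_
    intro f g hfg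
    exact LinearMap.ext_on hx (by rintro _ ⟨i, rfl⟩; exact congrFun hfg i)
  · rintro ⟨χ, hχ⟩
    apply gen_of_card_hom k M
    intro S _ _ _ _
    rw [card_hom_symm]
    by_cases hne : ∃ f : S →ₗ[R] M, f ≠ 0
    · obtain ⟨f, hf⟩ := hne
      have hcS := hC S f (LinearMap.injective_of_ne_zero hf)
      have hfin : Finite (S →+ C) := Nat.finite_of_card_ne_zero (by
        rw [hcS]; exact Nat.card_pos.ne')
      have : Nat.card (Fin k → (S →+ C)) = Nat.card S ^ k := by
        rw [Nat.card_fun, hcS]; simp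
      rw [← this]
      refine Nat.card_le_card_of_injective
        (fun (f : S →ₗ[R] M) i => (χ i).comp f.toAddMonoidHom) ?_
      intro f g hfg
      have h0 := hχ (LinearMap.range (f - g)) (by
        rintro i _ ⟨s, rfl⟩
        have := DFunLike.congr_fun (congrFun hfg i) s
        simp at this
        simp [this])
      rw [LinearMap.range_eq_bot] at h0
      exact sub_eq_zero.mp h0
    · push Not at hne
      have : Subsingleton (S →ₗ[R] M) := ⟨fun f g => by rw [hne f, hne g]⟩
      have h1 : 0 < Nat.card S := Nat.card_pos
      simp only [Nat.card_of_subsingleton (0 : S →ₗ[R] M)]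
      exact Nat.one_le_pow _ _ h1

end ModuleDuality

section GroupPart

theorem min_inf_eq_bot {G : Type*} [Group G] {M H : Subgroup G} (hM : IsMinimalNormal M)
    (hH : H.Normal) (h : ¬ M ≤ H) : M ⊓ H = ⊥ := by
  by_contra hne
  have := hM.1
  exact h (inf_eq_left.mp (hM.2.2 (M ⊓ H) inferInstance hne inf_le_left))

theorem min_commute {G : Type*} [Group G] {M H : Subgroup G} (hM : IsMinimalNormal M)
    (hH : H.Normal) (h : ¬ M ≤ H) {x y : G} (hx : x ∈ M) (hy : y ∈ H) : Commute x y :=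
  Subgroup.commute_of_normal_of_disjoint M H hM.1 hH
    (disjoint_iff.mpr (min_inf_eq_bot hM hH h)) x y hx hy

theorem minNormal_eq_of_le {G : Type*} [Group G] {M M' : Subgroup G} (hM : IsMinimalNormal M)
    (hM' : IsMinimalNormal M') (h : M ≤ M') : M = M' := hM'.2.2 M hM.1 hM.2.1 h

theorem min_min_commute {G : Type*} [Group G] {M M' : Subgroup G} (hM : IsMinimalNormal M)
    (hM' : IsMinimalNormal M') (h : M ≠ M') {x y : G} (hx : x ∈ M) (hy : y ∈ M') : Commute x y :=
  min_commute hM hM'.1 (fun hle => h (minNormal_eq_of_le hM hM' hle)) hx hy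

/-- elementwise commutativity of a subgroup -/
def IsAb {G : Type*} [Group G] (M : Subgroup G) : Prop := ∀ x ∈ M, ∀ y ∈ M, x * y = y * x

theorem min_center {G : Type*} [Group G] {M : Subgroup G} (hM : IsMinimalNormal M)
    (hna : ¬ IsAb M) {z : G} (hz : z ∈ M) (hc : ∀ y ∈ M, Commute z y) : z = 1 := by
  have := hM.1
  by_contra hz1
  have hz' : z ∈ Subgroup.centralizer (M : Set G) := by
    rw [Subgroup.mem_centralizer_iff]
    intro y hy
    exact (hc y hy).symm
  have hle : M ≤ Subgroup.centralizer (M : Set G) := by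
    by_contra hnle
    have h1 := min_inf_eq_bot hM (inferInstance : (Subgroup.centralizer (M : Set G)).Normal) hnle
    have h2 : z ∈ M ⊓ Subgroup.centralizer (M : Set G) := ⟨hz, hz'⟩
    rw [h1] at h2
    exact hz1 (by simpa using h2)
  apply hna
  intro x hx y hy
  exact (Subgroup.mem_centralizer_iff.mp (hle hx) y hy).symm

theorem sSup_commute {G : Type*} [Group G] {𝓢 : Set (Subgroup G)} {y : G}
    (h : ∀ M ∈ 𝓢, ∀ x ∈ M, Commute x y) {x : G} (hx : x ∈ sSup 𝓢) : Commute x y := by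
  have : sSup 𝓢 ≤ Subgroup.centralizer {y} := by
    refine sSup_le fun M hM x hx => ?_
    rw [Subgroup.mem_centralizer_singleton_iff]
    exact (h M hM x hx)
  exact (Subgroup.mem_centralizer_singleton_iff.mp (this hx))

theorem aSocle_commute {G : Type*} [Group G] {M : Subgroup G} (hM : IsMinimalNormal M)
    {a y : G} (ha : a ∈ aSocle G) (hy : y ∈ M) : Commute a y := by
  have key : ∀ M' ∈ {M : Subgroup G | IsMinimalNormal M ∧ ∀ x ∈ M, ∀ y ∈ M, x * y = y * x},
      ∀ x ∈ M', Commute x y := by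
    rintro M' ⟨hM', hab⟩ x hx
    by_cases h : M' = M
    · subst h; exact hab x hx y hy
    · exact min_min_commute hM' hM h hx hy
  exact sSup_commute key ha

theorem aSocle_comm {G : Type*} [Group G] : IsAb (aSocle G) := by
  intro x hx y hy
  exact (sSup_commute (fun M hM z hz => (aSocle_commute hM.1 hx hz).symm) hy).symm

theorem sSup_normal' {G : Type*} [Group G] (𝓢 : Set (Subgroup G)) (h : ∀ M ∈ 𝓢, M.Normal) :
    (sSup 𝓢).Normal := by
  rw [sSup_eq_iSup']
  have : ∀ i : 𝓢, (i : Subgroup G).Normal := fun i => h i i.2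
  infer_instance

theorem aSocle_normal {G : Type*} [Group G] : (aSocle G).Normal :=
  sSup_normal' _ fun _ h => h.1.1

theorem socle_normal {G : Type*} [Group G] : (socle G).Normal :=
  sSup_normal' _ fun _ h => h.1

theorem aSocle_le_socle {G : Type*} [Group G] : aSocle G ≤ socle G :=
  sSup_le_sSup fun _ h => h.1

theorem nonab_center {G : Type*} [Group G] [Finite G] (𝓢 : Set (Subgroup G))
    (h𝓢 : ∀ M ∈ 𝓢, IsMinimalNormal M ∧ ¬ IsAb M) : ∀ z ∈ sSup 𝓢,
    (∀ M ∈ 𝓢, ∀ y ∈ M, Commute z y) → z = 1 := by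
  have hfin : 𝓢.Finite := Set.toFinite _
  revert h𝓢
  refine Set.Finite.induction_on (motive := fun 𝓢 _ => (∀ M ∈ 𝓢, IsMinimalNormal M ∧ ¬ IsAb M) →
    ∀ z ∈ sSup 𝓢, (∀ M ∈ 𝓢, ∀ y ∈ M, Commute z y) → z = 1) 𝓢 hfin ?_ ?_
  · intro _ z hz _
    simpa using hz
  · intro M 𝓢' hM _ ih h z hz hc
    have hMm := h M (Set.mem_insert _ _)
    have hn := hMm.1.1
    rw [sSup_insert, Subgroup.mem_sup_of_normal_left] at hz
    obtain ⟨m, hm, z', hz', rfl⟩ := hz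
    have hz'M : ∀ y ∈ M, Commute z' y := fun y hy => sSup_commute (fun M' hM' x hx =>
      min_min_commute (h M' (Set.mem_insert_of_mem _ hM')).1 hMm.1
        (fun e => hM (e ▸ hM')) hx hy) hz'
    have hm1 : m = 1 := by
      refine min_center hMm.1 hMm.2 hm fun y hy => ?_
      have h1 := hc M (Set.mem_insert _ _) y hy
      have h2 := h1.mul_left (hz'M y hy).inv_left
      simpa using h2
    subst hm1
    rw [one_mul] at hc ⊢
    exact ih (fun M' hM' => h M' (Set.mem_insert_of_mem _ hM')) z' hz'
      fun M' hM' => hc M' (Set.mem_insert_of_mem _ hM')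

theorem nonab_elt {G : Type*} [Group G] [Finite G] (𝓢 : Set (Subgroup G))
    (h𝓢 : ∀ M ∈ 𝓢, IsMinimalNormal M ∧ ¬ IsAb M) :
    ∃ c ∈ sSup 𝓢, ∀ M ∈ 𝓢, ∃ y ∈ M, ¬ Commute c y := by
  have hfin : 𝓢.Finite := Set.toFinite _
  revert h𝓢
  refine Set.Finite.induction_on (motive := fun 𝓢 _ => (∀ M ∈ 𝓢, IsMinimalNormal M ∧ ¬ IsAb M) →
    ∃ c ∈ sSup 𝓢, ∀ M ∈ 𝓢, ∃ y ∈ M, ¬ Commute c y) 𝓢 hfin ?_ ?_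
  · intro _
    exact ⟨1, one_mem _, by simp⟩
  · intro M 𝓢' hM _ ih h
    have hMm := h M (Set.mem_insert _ _)
    obtain ⟨c, hc, hcy⟩ := ih (fun M' hM' => h M' (Set.mem_insert_of_mem _ hM'))
    have hcM : ∀ y ∈ M, Commute c y := fun y hy => sSup_commute (fun M' hM' x hx =>
      min_min_commute (h M' (Set.mem_insert_of_mem _ hM')).1 hMm.1
        (fun e => hM (e ▸ hM')) hx hy) hc
    have hna := hMm.2
    simp only [IsAb, not_forall] at hna
    obtain ⟨m, hm, y, hy, hmy⟩ := hna
    rw [sSup_insert]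
    refine ⟨c * m, mul_mem (Subgroup.mem_sup_right hc) (Subgroup.mem_sup_left hm), ?_⟩
    intro M' hM'
    rcases Set.mem_insert_iff.mp hM' with rfl | hM''
    · refine ⟨y, hy, fun hcom => hmy ?_⟩
      have h1 := ((hcM y hy).inv_left).mul_left hcom
      have h2 : Commute m y := by simpa using h1
      exact h2
    · obtain ⟨y', hy', hn'⟩ := hcy M' hM''
      refine ⟨y', hy', fun hcom => hn' ?_⟩
      have h1 : Commute m y' := min_min_commute hMm.1 (h M' hM').1 (fun e => hM (e ▸ hM'')) hm hy'
      have := hcom.mul_left h1.inv_left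
      simpa using this

/-- nonabelian minimal normal subgroups inside `N` -/
def nab {G : Type*} [Group G] (N : Subgroup G) : Set (Subgroup G) :=
  {M | (IsMinimalNormal M ∧ ¬ IsAb M) ∧ M ≤ N}

theorem nab_le {G : Type*} [Group G] (N : Subgroup G) : sSup (nab N) ≤ socle G ⊓ N :=
  sSup_le fun M hM => le_inf (le_sSup (a := M) (s := {M | IsMinimalNormal M}) hM.1.1) hM.2

theorem socle_decomp {G : Type*} [Group G] [Finite G] (N : Subgroup G) (hN : N.Normal) {t : G}
    (ht : t ∈ socle G ⊓ N) : ∃ b ∈ aSocle G ⊓ N, ∃ e ∈ sSup (nab N), t = b * e := by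
  set E2 : Set (Subgroup G) := {M | (IsMinimalNormal M ∧ ¬ IsAb M) ∧ ¬ M ≤ N} with hE2
  have hn1 : (sSup (nab N)).Normal := sSup_normal' _ fun M h => h.1.1.1
  have hn2 : (sSup E2).Normal := sSup_normal' _ fun M h => h.1.1.1
  have hle : socle G ≤ (sSup (nab N)) ⊔ (aSocle G ⊔ sSup E2) := by
    refine sSup_le fun M hM => ?_
    by_cases hab : IsAb M
    · exact le_trans (le_trans (le_sSup (a := M) (s := {M : Subgroup G | IsMinimalNormal M ∧
        ∀ x ∈ M, ∀ y ∈ M, x * y = y * x}) ⟨hM, hab⟩) (le_sup_left : aSocle G ≤ _)) le_sup_right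
    · by_cases hMN : M ≤ N
      · exact le_trans (le_sSup (show M ∈ nab N from ⟨⟨hM, hab⟩, hMN⟩)) le_sup_left
      · exact le_trans (le_trans (le_sSup (show M ∈ E2 from ⟨⟨hM, hab⟩, hMN⟩)) le_sup_right)
          le_sup_right
  have h1 := hle ht.1
  rw [sup_comm, Subgroup.mem_sup_of_normal_right] at h1
  obtain ⟨u, hu, e, he, rfl⟩ := h1
  rw [Subgroup.mem_sup_of_normal_right] at hu
  obtain ⟨a, ha, e2, he2, rfl⟩ := hu
  have haN : a * e2 ∈ N := by
    have := N.mul_mem ht.2 (N.inv_mem ((nab_le N) he).2)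
    simpa using this
  have he21 : e2 = 1 := by
    refine nonab_center E2 (fun M h => h.1) e2 he2 fun M hM y hy => ?_
    have h1 : Commute (a * e2) y := (min_commute hM.1.1 hN hM.2 hy haN).symm
    have h2 := (aSocle_commute hM.1.1 ha hy).inv_left.mul_left h1
    simpa using h2
  subst he21
  rw [mul_one] at haN ⊢
  exact ⟨a, ⟨ha, haN⟩, e, he, rfl⟩

theorem kgen_iff {G : Type*} [Group G] [Finite G] (N : Subgroup G) (hN : N.Normal) (k : ℕ)
    (hk : 1 ≤ k) : NormallyKGenerated (socle G ⊓ N) k ↔ NormallyKGenerated (aSocle G ⊓ N) k := by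
  have hA := aSocle_normal (G := G)
  have hS := socle_normal (G := G)
  have hE : (sSup (nab N)).Normal := sSup_normal' _ fun M h => h.1.1.1
  have hBn : (aSocle G ⊓ N).Normal := inferInstance
  have hTn : (socle G ⊓ N).Normal := inferInstance
  constructor
  · rintro ⟨f, hf, hgen⟩
    choose b hb e he hbe using fun i => socle_decomp N hN (hf i)
    refine ⟨b, hb, le_antisymm ?_ ?_⟩
    · exact Subgroup.normalClosure_le_normal (by rintro _ ⟨i, rfl⟩; exact hb i)
    · intro x hx
      have hxT : x ∈ socle G ⊓ N := ⟨aSocle_le_socle hx.1, hx.2⟩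
      have hle : socle G ⊓ N ≤ Subgroup.normalClosure (Set.range b) ⊔ sSup (nab N) := by
        rw [← hgen]
        refine Subgroup.normalClosure_le_normal ?_
        rintro _ ⟨i, rfl⟩
        rw [hbe i]
        exact mul_mem (Subgroup.mem_sup_left (Subgroup.subset_normalClosure ⟨i, rfl⟩))
          (Subgroup.mem_sup_right (he i))
      have h1 := hle hxT
      rw [Subgroup.mem_sup_of_normal_right] at h1
      obtain ⟨u, hu, v, hv, rfl⟩ := h1
      have huB : u ∈ aSocle G ⊓ N :=
        (Subgroup.normalClosure_le_normal (N := aSocle G ⊓ N)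
          (by rintro _ ⟨i, rfl⟩; exact hb i)) hu
      have hvB : v ∈ aSocle G ⊓ N := by
        have := (aSocle G ⊓ N).mul_mem ((aSocle G ⊓ N).inv_mem huB) hx
        simpa using this
      have hv1 : v = 1 := nonab_center (nab N) (fun M h => h.1) v hv
        fun M hM y hy => aSocle_commute hM.1.1 hvB.1 hy
      subst hv1
      simpa using hu
  · rintro ⟨x, hx, hgen⟩
    obtain ⟨c, hc, hcy⟩ := nonab_elt (nab N) fun M h => h.1
    let i0 : Fin k := ⟨0, hk⟩
    classical
    let f : Fin k → G := fun i => if i = i0 then x i * c else x i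
    have hf : ∀ i, f i ∈ socle G ⊓ N := by
      intro i
      have h1 : x i ∈ socle G ⊓ N := ⟨aSocle_le_socle (hx i).1, (hx i).2⟩
      by_cases h : i = i0
      · simp only [f, h, if_true]
        exact mul_mem (h ▸ h1) (nab_le N hc)
      · simpa only [f, h, if_false] using h1
    refine ⟨f, hf, le_antisymm ?_ ?_⟩
    · exact Subgroup.normalClosure_le_normal (by rintro _ ⟨i, rfl⟩; exact hf i)
    · set L := Subgroup.normalClosure (Set.range f) with hL
      have hLn : L.Normal := Subgroup.normalClosure_normal
      have hf0 : x i0 * c ∈ L := Subgroup.subset_normalClosure ⟨i0, by simp [f]⟩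
      have hEL : sSup (nab N) ≤ L := by
        refine sSup_le fun M hM => ?_
        by_contra hnle
        obtain ⟨y, hy, hny⟩ := hcy M hM
        apply hny
        have h1 : Commute (x i0 * c) y := (min_commute hM.1.1 hLn hnle hy hf0).symm
        have h2 := (aSocle_commute hM.1.1 (hx i0).1 hy).inv_left.mul_left h1
        simpa using h2
      have hxL : ∀ i, x i ∈ L := by
        intro i
        by_cases h : i = i0
        · subst h
          have := L.mul_mem hf0 (L.inv_mem (hEL hc))
          simpa using this
        · exact Subgroup.subset_normalClosure ⟨i, by simp [f, h]⟩
      have hBL : aSocle G ⊓ N ≤ L := by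
        rw [← hgen]
        exact Subgroup.normalClosure_le_normal (by rintro _ ⟨i, rfl⟩; exact hxL i)
      intro t ht
      obtain ⟨b, hb, e, he, rfl⟩ := socle_decomp N hN ht
      exact mul_mem (hBL hb) (hEL he)

end GroupPart

section CommPart

open scoped IsMulCommutative

section BridgePart

variable {H : Type} [Group H] (A : Subgroup H) [A.Normal] [IsMulCommutative A]

/-- conjugation by `g` as an additive endomorphism of `A` -/
def conjEnd (g : H) : AddMonoid.End (Additive A) :=
  MonoidHom.toAdditive (MulAut.conjNormal g : A ≃* A).toMonoidHom

/-- the ring generated by conjugations -/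
abbrev conjRing : Subring (AddMonoid.End (Additive A)) :=
  Subring.closure (Set.range (conjEnd A))

theorem conjEnd_apply (g : H) (x : Additive A) :
    ((Additive.toMul (conjEnd A g x) : A) : H) = g * (Additive.toMul x : A) * g⁻¹ := rfl

/-- subgroup attached to a submodule -/
def toSub (D : Submodule (conjRing A) (Additive A)) : Subgroup H where
  carrier := {g | ∃ h : g ∈ A, Additive.ofMul (⟨g, h⟩ : A) ∈ D}
  one_mem' := ⟨one_mem _, D.zero_mem⟩
  mul_mem' := by
    rintro a b ⟨ha, ha'⟩ ⟨hb, hb'⟩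
    exact ⟨mul_mem ha hb, D.add_mem ha' hb'⟩
  inv_mem' := by
    rintro a ⟨ha, ha'⟩
    exact ⟨inv_mem ha, D.neg_mem ha'⟩

theorem toSub_normal (D : Submodule (conjRing A) (Additive A)) : (toSub A D).Normal := by
  constructor
  rintro n ⟨hn, hnD⟩ g
  have hg : conjEnd A g ∈ conjRing A := Subring.subset_closure ⟨g, rfl⟩
  exact ⟨Subgroup.Normal.conj_mem inferInstance n hn g, D.smul_mem ⟨_, hg⟩ hnD⟩

/-- submodule attached to a normal subgroup -/
def ofSub (K : Subgroup H) (hK : K.Normal) : Submodule (conjRing A) (Additive A) where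
  carrier := {x | ((Additive.toMul x : A) : H) ∈ K}
  zero_mem' := K.one_mem
  add_mem' := fun ha hb => K.mul_mem ha hb
  smul_mem' := by
    rintro ⟨r, hr⟩ x hx
    change ((Additive.toMul (r x) : A) : H) ∈ K
    revert x
    induction hr using Subring.closure_induction with
    | mem r hr =>
      obtain ⟨g, rfl⟩ := hr
      intro x hx
      rw [conjEnd_apply]
      exact hK.conj_mem _ hx g
    | zero => intro x hx; exact K.one_mem
    | one => intro x hx; exact hx
    | add a b _ _ ha hb => intro x hx; exact K.mul_mem (ha hx) (hb hx)
    | neg a _ ha => intro x hx; exact K.inv_mem (ha hx)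
    | mul a b _ _ ha hb => intro x hx; exact ha (hb hx)

theorem mem_ofSub {K : Subgroup H} {hK : K.Normal} {x : Additive A} :
    x ∈ ofSub A K hK ↔ ((Additive.toMul x : A) : H) ∈ K := Iff.rfl

theorem mem_toSub {D : Submodule (conjRing A) (Additive A)} {x : Additive A} :
    ((Additive.toMul x : A) : H) ∈ toSub A D ↔ x ∈ D :=
  ⟨fun ⟨_, h⟩ => h, fun h => ⟨(Additive.toMul x).2, h⟩⟩

theorem toSub_le (D : Submodule (conjRing A) (Additive A)) : toSub A D ≤ A := fun _ h => h.1

theorem ofMul_eq_zero' {x : Additive A} : x = 0 ↔ ((Additive.toMul x : A) : H) = 1 :=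
  ⟨fun h => by subst h; rfl, fun h => Additive.toMul.injective (Subtype.ext h)⟩

theorem ofSub_isSimple {M : Subgroup H} (hM : IsMinimalNormal M) (hMA : M ≤ A) :
    IsSimpleModule (conjRing A) (ofSub A M hM.1) := by
  rw [isSimpleModule_iff_isAtom]
  constructor
  · intro h
    apply hM.2.1
    rw [eq_bot_iff]
    intro m hm
    have h1 : Additive.ofMul (⟨m, hMA hm⟩ : A) ∈ ofSub A M hM.1 := hm
    rw [h, Submodule.mem_bot, ofMul_eq_zero'] at h1
    exact h1
  · intro D hD
    by_contra hne
    have h1 : toSub A D ≤ M := by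
      rintro g ⟨hg, hg'⟩
      exact hD.le hg'
    have h2 : toSub A D ≠ ⊥ := by
      intro h
      apply hne
      rw [eq_bot_iff]
      intro x hx
      have h3 := (mem_toSub A).mpr hx
      rw [h, Subgroup.mem_bot] at h3
      exact (ofMul_eq_zero' A).mpr h3
    have h3 := hM.2.2 _ (toSub_normal A D) h2 h1
    apply hD.not_ge
    intro x hx
    rw [mem_ofSub, ← h3] at hx
    exact (mem_toSub A).mp hx

end BridgePart

theorem card_char {K : Type} [Field K] [IsAlgClosed K] (S : Type) [AddCommGroup S] [Finite S]
    (n : ℕ) (hn : (n : K) ≠ 0) (hd : Nat.card S ∣ n) :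
    Nat.card (S →+ Additive Kˣ) = Nat.card S := by
  have h0 : ((Monoid.exponent (Multiplicative S) : ℕ) : K) ≠ 0 := by
    have h1 : Monoid.exponent (Multiplicative S) ∣ n :=
      (Group.exponent_dvd_nat_card (G := Multiplicative S)).trans hd
    obtain ⟨c, hc⟩ := h1
    intro h
    apply hn
    rw [hc, Nat.cast_mul, h, zero_mul]
  have : NeZero ((Monoid.exponent (Multiplicative S) : ℕ) : K) := ⟨h0⟩
  have h2 := CommGroup.card_monoidHom_of_hasEnoughRootsOfUnity (Multiplicative S) K
  rw [Nat.card_congr (Multiplicative.toAdd : Multiplicative S ≃ S)] at h2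
  rw [← h2]
  exact Nat.card_congr
    { toFun := fun f => AddMonoidHom.toMultiplicativeLeft f
      invFun := fun f => AddMonoidHom.toMultiplicativeLeft.symm f
      left_inv := fun f => by simp
      right_inv := fun f => by simp }

theorem aSocle_semisimple {H : Type} [Group H] [(aSocle H).Normal] [IsMulCommutative (aSocle H)] :
    IsSemisimpleModule (conjRing (aSocle H)) (Additive (aSocle H)) := by
  apply IsSemisimpleModule.of_sSup_simples_eq_top
  rw [eq_top_iff]
  intro x _
  rw [← mem_toSub]
  have hle : aSocle H ≤ toSub (aSocle H) (sSup {m : Submodule (conjRing (aSocle H)) (Additive (aSocle H)) | IsSimpleModule (conjRing (aSocle H)) m}) := by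
    refine sSup_le fun M hM => ?_
    have hMA : M ≤ aSocle H := le_sSup (a := M) (s := {M : Subgroup H | IsMinimalNormal M ∧
        ∀ x ∈ M, ∀ y ∈ M, x * y = y * x}) hM
    have h1 := ofSub_isSimple (aSocle H) hM.1 hMA
    have h2 : ofSub (aSocle H) M hM.1.1 ≤ sSup {m : Submodule (conjRing (aSocle H)) (Additive (aSocle H)) | IsSimpleModule (conjRing (aSocle H)) m} :=
      le_sSup h1
    intro m hm
    exact ⟨hMA hm, h2 (show Additive.ofMul (⟨m, hMA hm⟩ : aSocle H) ∈ ofSub (aSocle H) M hM.1.1 from hm)⟩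
  exact hle (Additive.toMul x).2

theorem kgen_iff_chars {G : Type} [Group G] [Finite G] (N : Subgroup G) (hN : N.Normal) (k : ℕ)
    (K : Type) [Field K] [IsAlgClosed K] (hc : ((Nat.card ↥(aSocle G ⊓ N) : ℕ) : K) ≠ 0) :
    NormallyKGenerated (aSocle G ⊓ N) k ↔
    ∃ χ : Fin k → (↥(aSocle G ⊓ N) →* Kˣ), ∀ H : Subgroup G, H.Normal → ∀ hH : H ≤ aSocle G ⊓ N,
      (∀ i, ∀ h (hh : h ∈ H), χ i ⟨h, hH hh⟩ = 1) → H = ⊥ := by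
  have hA := aSocle_normal (G := G)
  have hAc : IsMulCommutative (aSocle G) :=
    IsMulCommutative.of_setLike_mul_comm fun a ha b hb => aSocle_comm a ha b hb
  have hss := aSocle_semisimple (H := G)
  set A := aSocle G with hAdef
  have hBn : (A ⊓ N).Normal := inferInstance
  let B' : Submodule (conjRing A) (Additive A) := ofSub A N hN
  have hB' : ∀ x : B', ((Additive.toMul (x : Additive A) : A) : G) ∈ A ⊓ N := fun x =>
    ⟨(Additive.toMul (x : Additive A)).2, x.2⟩
  let e : Multiplicative B' ≃* ↥(A ⊓ N) :=
    { toFun := fun x => ⟨_, hB' (Multiplicative.toAdd x)⟩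
      invFun := fun b => Multiplicative.ofAdd ⟨Additive.ofMul ⟨b.1, b.2.1⟩, b.2.2⟩
      left_inv := fun x => rfl
      right_inv := fun x => rfl
      map_mul' := fun x y => rfl }
  have hcard : Nat.card B' = Nat.card ↥(A ⊓ N) := Nat.card_congr e.toEquiv
  have key := gen_iff_cogen (R := conjRing A) (Additive Kˣ) k B' (by
    intro S _ _ _ f hf
    apply card_char S _ hc
    rw [← hcard]
    exact AddSubgroup.card_dvd_of_injective f.toAddMonoidHom hf)
  have h1 : NormallyKGenerated (A ⊓ N) k ↔
      ∃ x : Fin k → B', Submodule.span (conjRing A) (Set.range x) = ⊤ := by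
    constructor
    · rintro ⟨f, hf, hgen⟩
      refine ⟨fun i => ⟨Additive.ofMul ⟨f i, (hf i).1⟩, (hf i).2⟩, ?_⟩
      set X := Submodule.span (conjRing A)
        (Set.range fun i => (⟨Additive.ofMul ⟨f i, (hf i).1⟩, (hf i).2⟩ : B')) with hX
      have hle : A ⊓ N ≤ toSub A (X.map B'.subtype) := by
        rw [← hgen]
        have := toSub_normal A (X.map B'.subtype)
        refine Subgroup.normalClosure_le_normal ?_
        rintro _ ⟨i, rfl⟩
        refine ⟨(hf i).1, ?_⟩
        exact ⟨_, Submodule.subset_span ⟨i, rfl⟩, rfl⟩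
      rw [eq_top_iff]
      intro x _
      obtain ⟨_, y, hy, hxy⟩ := hle (hB' x)
      have : y = x := Subtype.ext hxy
      exact this ▸ hy
    · rintro ⟨x, hx⟩
      refine ⟨fun i => ((Additive.toMul (x i : Additive A) : A) : G), fun i => hB' (x i),
        le_antisymm ?_ ?_⟩
      · exact Subgroup.normalClosure_le_normal (by rintro _ ⟨i, rfl⟩; exact hB' (x i))
      · set L := Subgroup.normalClosure
          (Set.range fun i => ((Additive.toMul (x i : Additive A) : A) : G)) with hL
        have hLn : L.Normal := Subgroup.normalClosure_normal
        have hle : (⊤ : Submodule (conjRing A) B') ≤ (ofSub A L hLn).comap B'.subtype := by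
          rw [← hx, Submodule.span_le]
          rintro _ ⟨i, rfl⟩
          exact Subgroup.subset_normalClosure ⟨i, rfl⟩
        intro b hb
        exact hle (x := ⟨Additive.ofMul ⟨b, hb.1⟩, hb.2⟩) Submodule.mem_top
  rw [h1, key]
  constructor
  · rintro ⟨χ, hχ⟩
    refine ⟨fun i => (AddMonoidHom.toMultiplicativeLeft (χ i)).comp e.symm.toMonoidHom, ?_⟩
    intro H hHn hH h
    have h2 := hχ ((ofSub A H hHn).comap B'.subtype) (fun i z hz => h i _ hz)
    rw [eq_bot_iff]
    intro g hg
    have h3 : (⟨Additive.ofMul ⟨g, (hH hg).1⟩, (hH hg).2⟩ : B') ∈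
      (ofSub A H hHn).comap B'.subtype := hg
    rw [h2, Submodule.mem_bot] at h3
    have h4 := congrArg (fun x : B' => ((Additive.toMul (x : Additive A) : A) : G)) h3
    exact h4
  · rintro ⟨χ, hχ⟩
    refine ⟨fun i => AddMonoidHom.toMultiplicativeLeft.symm ((χ i).comp e.toMonoidHom), ?_⟩
    intro Z hZ
    have hle : toSub A (Z.map B'.subtype) ≤ A ⊓ N := by
      rintro g ⟨hg, y, hy, hxy⟩
      have := hB' y
      simp only [Submodule.subtype_apply] at hxy
      rw [hxy] at this
      exact this
    have h2 := hχ (toSub A (Z.map B'.subtype)) (toSub_normal A _) hle (by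
      intro i g hg
      have hg0 := hg
      obtain ⟨hg1, y, hy, hxy⟩ := hg0
      have h3 := hZ i y hy
      have h4 : (⟨g, hle hg⟩ : ↥(A ⊓ N)) = e (Multiplicative.ofAdd y) := by
        apply Subtype.ext
        have := congrArg (fun x : Additive A => ((Additive.toMul x : A) : G)) hxy
        exact this.symm
      rw [h4]
      exact h3)
    rw [eq_bot_iff]
    intro z hz
    have h3 : ((Additive.toMul (z : Additive A) : A) : G) ∈ toSub A (Z.map B'.subtype) :=
      (mem_toSub A).mpr ⟨z, hz, rfl⟩
    rw [h2, Subgroup.mem_bot] at h3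
    exact Subtype.ext ((ofMul_eq_zero' A).mpr h3)
end CommPart

section RepPart

theorem exists_hom_eigen {F K R V : Type} [Field F] [Field K] [Algebra F K] [IsAlgClosed K]
    [CommRing R] [Algebra F R] [Module.Finite F R] [AddCommGroup V] [Module R V] [Nontrivial V] :
    ∃ (f : R →ₐ[F] K) (u : V), u ≠ 0 ∧ ∀ r, f r = 0 → r • u = 0 := by
  have hnoeth : IsNoetherianRing R := isNoetherian_of_tower F (isNoetherian_of_isNoetherianRing_of_finite F R)
  obtain ⟨P, hP⟩ := associatedPrimes.nonempty R V
  have hprime := hP.isPrime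
  obtain ⟨_, u, hu⟩ := isAssociatedPrime_iff.mp hP
  have hinj : Function.Injective (algebraMap F (R ⧸ P)) := (algebraMap F (R ⧸ P)).injective
  have : FaithfulSMul F (R ⧸ P) := (faithfulSMul_iff_algebraMap_injective F (R ⧸ P)).mpr hinj
  let f : (R ⧸ P) →ₐ[F] K := IsAlgClosed.lift
  have hfield : IsField (R ⧸ P) :=
    isField_of_isIntegral_of_isField' (R := F) (Field.toIsField F)
  have hf : Function.Injective f := by
    letI := hfield.toField
    exact RingHom.injective (f : (R ⧸ P) →+* K)
  refine ⟨f.comp (Ideal.Quotient.mkₐ F P), u, ?_, ?_⟩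
  · rintro rfl
    apply hprime.ne_top
    rw [hu]
    ext r
    simp
  · intro r hr
    have h1 : Ideal.Quotient.mkₐ F P r = 0 := hf (by simpa using hr)
    have h2 : r ∈ P := Ideal.Quotient.eq_zero_iff_mem.mp h1
    rw [hu] at h2
    simpa using h2

theorem exists_char_eigen {F K G Q V : Type} [Field F] [Field K] [Algebra F K] [IsAlgClosed K]
    [Group G] [CommGroup Q] [Finite Q] (ι : Q →* G) [AddCommGroup V]
    [Module (MonoidAlgebra F G) V] [Nontrivial V] :
    ∃ (χ : Q →* Kˣ) (u : V), u ≠ 0 ∧ ∀ q, χ q = 1 → MonoidAlgebra.of F G (ι q) • u = u := by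
  let φ : MonoidAlgebra F Q →ₐ[F] MonoidAlgebra F G := MonoidAlgebra.mapDomainAlgHom F F ι
  letI : Module (MonoidAlgebra F Q) V := Module.compHom V φ.toRingHom
  obtain ⟨f, u, hu, h⟩ := exists_hom_eigen (F := F) (K := K) (R := MonoidAlgebra F Q) (V := V)
  refine ⟨((f : MonoidAlgebra F Q →* K).comp (MonoidAlgebra.of F Q)).toHomUnits, u, hu, ?_⟩
  intro q hq
  have h1 : f (MonoidAlgebra.of F Q q) = 1 := by
    have := congrArg Units.val hq
    simpa using this
  have h2 := h (MonoidAlgebra.of F Q q - 1) (by rw [map_sub, h1, map_one, sub_self])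
  rw [sub_smul, one_smul, sub_eq_zero] at h2
  have h3 : φ (MonoidAlgebra.of F Q q) = MonoidAlgebra.of F G (ι q) := by
    simp [φ]
  rw [← h3]
  exact h2

theorem exists_maximal_left {F K G Q : Type} [Field F] [Field K] [Algebra F K]
    [Algebra.IsAlgebraic F K]
    [Group G] [CommGroup Q] (ι : Q →* G) (hι : Function.Injective ι) (ψ : Q →* Kˣ) :
    ∃ m : Submodule (MonoidAlgebra F G) (MonoidAlgebra F G), IsCoatom m ∧
      ∀ q, MonoidAlgebra.of F G (ι q) - 1 ∈ m → ψ q = 1 := by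
  classical
  let φ : MonoidAlgebra F Q →ₐ[F] MonoidAlgebra F G := MonoidAlgebra.mapDomainAlgHom F F ι
  let p : MonoidAlgebra F Q →ₐ[F] K :=
    MonoidAlgebra.lift F K Q ((Units.coeHom K).comp ψ)
  have hp : ∀ q c, p (MonoidAlgebra.single q c) = c • (ψ q : K) := by
    intro q c; simp [p, MonoidAlgebra.lift_single]
  let w : G → K := fun g => if h : ∃ q, ι q = g then (ψ h.choose : K) else 0
  have hw : ∀ q, w (ι q) = ψ q := by
    intro q
    have h : ∃ q', ι q' = ι q := ⟨q, rfl⟩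
    simp only [w, dif_pos h]
    rw [hι h.choose_spec]
  have hw' : ∀ g q, w (g * ι q) = w g * ψ q := by
    intro g q
    by_cases h : ∃ q', ι q' = g
    · obtain ⟨q', rfl⟩ := h
      rw [← map_mul, hw, hw, map_mul, Units.val_mul]
    · have h' : ¬ ∃ q', ι q' = g * ι q := by
        rintro ⟨q', hq'⟩
        exact h ⟨q' * q⁻¹, by rw [map_mul, hq', map_inv, mul_inv_cancel_right]⟩
      simp only [w, dif_neg h, dif_neg h', zero_mul]
  let L : MonoidAlgebra F G →+ K :=
    { toFun := fun x => x.coeff.sum fun g c => c • w g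
      map_zero' := by simp
      map_add' := fun x y => by
        rw [MonoidAlgebra.coeff_add]
        exact Finsupp.sum_add_index' (fun _ => zero_smul _ _) (fun _ _ _ => add_smul _ _ _) }
  have hL : ∀ g c, L (MonoidAlgebra.single g c) = c • w g := by
    intro g c
    exact Finsupp.sum_single_index (h := fun g c => c • w g) (zero_smul F _)
  have hφ : ∀ q c, φ (MonoidAlgebra.single q c) = MonoidAlgebra.single (ι q) c := by
    intro q c; simp [φ]
  have hLmul : ∀ y a, L (y * φ a) = L y * p a := by
    intro y a
    induction a using MonoidAlgebra.induction_linear with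
    | zero => simp
    | add a b ha hb => rw [map_add, mul_add, map_add, ha, hb, map_add, mul_add]
    | single q c =>
      induction y using MonoidAlgebra.induction_linear with
      | zero => simp
      | add a b ha hb => rw [add_mul, map_add, ha, hb, map_add, add_mul]
      | single g d =>
        rw [hφ, MonoidAlgebra.single_mul_single, hL, hL, hp, hw']
        rw [smul_mul_smul_comm]
  let J : Submodule (MonoidAlgebra F G) (MonoidAlgebra F G) :=
    { carrier := {x | ∀ y, L (y * x) = 0}
      zero_mem' := fun y => by rw [mul_zero, map_zero]
      add_mem' := fun {a b} ha hb y => by rw [mul_add, map_add, ha, hb, add_zero]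
      smul_mem' := fun c x hx y => by rw [smul_eq_mul, ← mul_assoc]; exact hx _ }
  have hJ : J ≠ ⊤ := by
    intro h
    have h1 : (1 : MonoidAlgebra F G) ∈ J := h ▸ Submodule.mem_top
    have h2 := h1 1
    rw [mul_one, MonoidAlgebra.one_def, hL, one_smul, ← map_one ι, hw, map_one] at h2
    simp at h2
  obtain ⟨m, hm, hJm⟩ := (eq_top_or_exists_le_coatom J).resolve_left hJ
  refine ⟨m, hm, ?_⟩
  have h1m : (1 : MonoidAlgebra F G) ∉ m := by
    intro h
    apply hm.1
    rw [eq_top_iff]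
    intro x _
    have := m.smul_mem x h
    rwa [smul_eq_mul, mul_one] at this
  intro q hq
  by_contra hne
  have hne' : p (MonoidAlgebra.of F Q q - 1) ≠ 0 := by
    rw [map_sub, map_one, MonoidAlgebra.of_apply, hp, one_smul, sub_ne_zero]
    intro h
    exact hne (Units.ext h)
  have hfield : IsField p.range := by
    have : Algebra.IsIntegral F p.range := by
      have : Algebra.IsIntegral F K := inferInstance
      exact Algebra.IsIntegral.of_injective p.range.val Subtype.val_injective
    exact isField_of_isIntegral_of_isField' (R := F) (Field.toIsField F)
  obtain ⟨⟨_, b, rfl⟩, hb⟩ := hfield.mul_inv_cancel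
    (a := ⟨p (MonoidAlgebra.of F Q q - 1), _, rfl⟩) (by
      intro h; exact hne' (congrArg Subtype.val h))
  have hb' : p (b * (MonoidAlgebra.of F Q q - 1)) = 1 := by
    have := congrArg Subtype.val hb
    rw [map_mul, mul_comm]
    exact this
  apply h1m
  have e1 : φ (1 - b * (MonoidAlgebra.of F Q q - 1)) ∈ m := by
    apply hJm
    intro y
    rw [hLmul, map_sub, hb', map_one, sub_self, mul_zero]
  have e2 : φ (b * (MonoidAlgebra.of F Q q - 1)) ∈ m := by
    rw [map_mul]
    apply m.smul_mem (φ b)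
    have : φ (MonoidAlgebra.of F Q q - 1) = MonoidAlgebra.of F G (ι q) - 1 := by
      rw [map_sub, map_one, MonoidAlgebra.of_apply, hφ, MonoidAlgebra.of_apply]
    rw [this]
    exact hq
  have e3 := m.add_mem e1 e2
  rwa [← map_add, sub_add_cancel, map_one] at e3

end RepPart

section RepTransfer

/-- the submodule of vectors fixed by a normal subgroup -/
def fixSub {F G V : Type} [Field F] [Group G] [AddCommGroup V] [Module (MonoidAlgebra F G) V]
    (D : Subgroup G) (hD : D.Normal) : Submodule (MonoidAlgebra F G) V where
  carrier := {v | ∀ d ∈ D, MonoidAlgebra.of F G d • v = v}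
  zero_mem' := fun d _ => smul_zero _
  add_mem' := fun {a b} ha hb d hd => by rw [smul_add, ha d hd, hb d hd]
  smul_mem' := by
    intro c x hx d hd
    induction c using MonoidAlgebra.induction_linear with
    | zero => rw [zero_smul, smul_zero]
    | add a b ha hb => rw [add_smul, smul_add, ha, hb]
    | single g r =>
      have h1 : MonoidAlgebra.of F G d * MonoidAlgebra.single g r =
          MonoidAlgebra.single g r * MonoidAlgebra.of F G (g⁻¹ * d * g) := by
        rw [MonoidAlgebra.of_apply, MonoidAlgebra.of_apply, MonoidAlgebra.single_mul_single,
          MonoidAlgebra.single_mul_single, one_mul, mul_one]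
        congr 1
        group
      rw [smul_smul, h1, ← smul_smul]
      have h2 := hx (g⁻¹ * d * g) (by simpa using hD.conj_mem d hd g⁻¹)
      rw [h2]

theorem exists_rep_equiv {F G V : Type} [Field F] [Group G] [AddCommGroup V] [Module F V]
    [Module (MonoidAlgebra F G) V] [IsScalarTower F (MonoidAlgebra F G) V] [Module.Finite F V] :
    ∃ (n : ℕ) (ρ : Representation F G (Fin n → F)) (_ : V ≃ₗ[MonoidAlgebra F G] ρ.asModule),
      ∀ g, (∀ v : Fin n → F, ρ g v = v) → ∀ x : V, MonoidAlgebra.of F G g • x = x := by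
  let n := Module.finrank F V
  let e : V ≃ₗ[F] (Fin n → F) := (Module.finBasis F V).equivFun
  have hcomm : ∀ (a : MonoidAlgebra F G) (c : F) (x : V), a • c • x = c • a • x := by
    intro a c x
    rw [← algebraMap_smul (MonoidAlgebra F G) c x, ← algebraMap_smul (MonoidAlgebra F G) c (a • x),
      smul_smul, smul_smul, Algebra.commutes]
  let T : G → (V →ₗ[F] V) := fun g =>
    { toFun := fun x => MonoidAlgebra.of F G g • x
      map_add' := fun x y => smul_add _ _ _
      map_smul' := fun c x => hcomm _ c x }
  let ρ : Representation F G (Fin n → F) :=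
    { toFun := fun g => e.toLinearMap ∘ₗ (T g) ∘ₗ e.symm.toLinearMap
      map_one' := by
        refine LinearMap.ext fun v => ?_
        change e (MonoidAlgebra.of F G 1 • e.symm v) = v
        rw [map_one, one_smul, LinearEquiv.apply_symm_apply]
      map_mul' := fun a b => by
        refine LinearMap.ext fun v => ?_
        change e (MonoidAlgebra.of F G (a * b) • e.symm v) =
          e (MonoidAlgebra.of F G a • e.symm (e (MonoidAlgebra.of F G b • e.symm v)))
        rw [map_mul, mul_smul, LinearEquiv.symm_apply_apply] }
  have hρ : ∀ g v, ρ g v = e (MonoidAlgebra.of F G g • e.symm v) := fun g v => rfl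
  have hs : ∀ (r : MonoidAlgebra F G) (x : V),
      ρ.asModuleEquiv.symm (e (r • x)) = r • ρ.asModuleEquiv.symm (e x) := by
    intro r x
    induction r using MonoidAlgebra.induction_linear with
    | zero => rw [zero_smul, zero_smul, map_zero, map_zero]
    | add a b ha hb => rw [add_smul, map_add, map_add, ha, hb, add_smul]
    | single g c =>
      rw [Representation.single_smul]
      have h1 : (MonoidAlgebra.single g c : MonoidAlgebra F G) = c • MonoidAlgebra.of F G g := by
        rw [MonoidAlgebra.of_apply, MonoidAlgebra.smul_single', mul_one]
      rw [h1, smul_assoc, map_smul, LinearEquiv.apply_symm_apply, hρ, LinearEquiv.symm_apply_apply]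
      rfl
  let E : V ≃ₗ[MonoidAlgebra F G] ρ.asModule :=
    { toFun := fun x => ρ.asModuleEquiv.symm (e x)
      invFun := fun y => e.symm (ρ.asModuleEquiv y)
      left_inv := fun x => by simp
      right_inv := fun x => by simp
      map_add' := fun x y => by simp
      map_smul' := hs }
  refine ⟨n, ρ, E, ?_⟩
  intro g hg x
  have := hg (e x)
  rw [hρ, LinearEquiv.symm_apply_apply] at this
  exact e.injective this

theorem exists_rep {F G : Type} [Field F] [Group G] [Finite G] (k : ℕ)
    (m : Fin k → Submodule (MonoidAlgebra F G) (MonoidAlgebra F G)) (hm : ∀ i, IsCoatom (m i)) :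
    ∃ (n : ℕ) (ρ : Representation F G (Fin n → F)),
        (∀ g, (∀ v : Fin n → F, ρ g v = v) → ∀ i, ∀ x : MonoidAlgebra F G,
          MonoidAlgebra.of F G g * x - x ∈ m i) ∧
        ∃ W : Fin k → Submodule (MonoidAlgebra F G) ρ.asModule,
          (∀ i, IsSimpleModule (MonoidAlgebra F G) ↥(W i)) ∧
          DirectSum.IsInternal W := by
  obtain ⟨n, ρ, E, hE⟩ := exists_rep_equiv (F := F) (G := G)
    (V := (i : Fin k) → (MonoidAlgebra F G ⧸ m i))
  refine ⟨n, ρ, ?_, fun i => (LinearMap.range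
    (LinearMap.single (MonoidAlgebra F G) (fun i => MonoidAlgebra F G ⧸ m i) i)).map
      E.toLinearMap, ?_, ?_⟩
  · intro g hg i x
    have h2 := congrFun (hE g hg (fun i => Submodule.Quotient.mk x)) i
    rw [Pi.smul_apply, ← Submodule.Quotient.mk_smul, Submodule.Quotient.eq] at h2
    exact h2
  · intro i
    have h1 : IsSimpleModule (MonoidAlgebra F G) (MonoidAlgebra F G ⧸ m i) :=
      isSimpleModule_iff_isCoatom.mpr (hm i)
    have h2 : Function.Injective (LinearMap.single (MonoidAlgebra F G)
      (fun i => MonoidAlgebra F G ⧸ m i) i) := by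
      rw [LinearMap.coe_single]
      exact Pi.single_injective (M := fun i => MonoidAlgebra F G ⧸ m i) i
    exact IsSimpleModule.congr ((LinearEquiv.ofInjective _ h2).trans (E.submoduleMap _)).symm
  · apply DirectSum.isInternal_submodule_of_iSupIndep_of_iSup_eq_top
    · apply LinearMap.iSupIndep_map _ E.injective
      intro i
      have := LinearMap.disjoint_single_single (MonoidAlgebra F G)
        (fun i => MonoidAlgebra F G ⧸ m i) {i} {i}ᶜ disjoint_compl_right
      simpa using this
    · rw [← Submodule.map_iSup, LinearMap.iSup_range_single, Submodule.map_top]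
      exact LinearMap.range_eq_top.mpr E.surjective

theorem chars_of_rep {G : Type} [Group G] [Finite G] (N : Subgroup G) (B : Subgroup G)
    (hBN : B ≤ N) (hB : IsAb B) (F K : Type) [Field F] [Field K] [Algebra F K] [IsAlgClosed K]
    (k n : ℕ) (ρ : Representation F G (Fin n → F))
    (hf : ∀ g ∈ N, (∀ v : Fin n → F, ρ g v = v) → g = 1)
    (W : Fin k → Submodule (MonoidAlgebra F G) ρ.asModule)
    (hW : ∀ i, IsSimpleModule (MonoidAlgebra F G) ↥(W i)) (hInternal : DirectSum.IsInternal W) :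
    ∃ χ : Fin k → (B →* Kˣ), ∀ H : Subgroup G, H.Normal → ∀ hH : H ≤ B,
      (∀ i, ∀ h (hh : h ∈ H), χ i ⟨h, hH hh⟩ = 1) → H = ⊥ := by
  have key : ∀ i, ∃ (χ : B →* Kˣ) (u : W i), u ≠ 0 ∧
      ∀ q : B, χ q = 1 → MonoidAlgebra.of F G (q : G) • u = u := by
    intro i
    let : CommGroup B :=
      { (inferInstance : Group B) with
        mul_comm := fun a b => Subtype.ext (hB a a.2 b b.2) }
    have := (hW i).nontrivial
    exact exists_char_eigen (F := F) (K := K) (G := G) (V := W i) B.subtype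
  choose χ u hu hχ using key
  refine ⟨χ, ?_⟩
  intro H hHn hH h
  have hfix : ∀ i, fixSub (F := F) (V := W i) H hHn = ⊤ := by
    intro i
    have := (hW i).toIsSimpleOrder
    refine (eq_bot_or_eq_top _).resolve_left ?_
    intro hbot
    apply hu i
    have h1 : u i ∈ fixSub (F := F) (V := W i) H hHn := fun d hd => hχ i ⟨d, hH hd⟩ (h i d hd)
    rw [hbot] at h1
    simpa using h1
  have hfix2 : fixSub (F := F) (V := ρ.asModule) H hHn = ⊤ := by
    rw [eq_top_iff, ← hInternal.submodule_iSup_eq_top]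
    refine iSup_le fun i x hx d hd => ?_
    have h1 : (⟨x, hx⟩ : W i) ∈ fixSub (F := F) (V := W i) H hHn := hfix i ▸ Submodule.mem_top
    exact congrArg Subtype.val (h1 d hd)
  rw [eq_bot_iff]
  intro d hd
  refine hf d (hBN (hH hd)) fun v => ?_
  have h1 : ρ.asModuleEquiv.symm v ∈ fixSub (F := F) (V := ρ.asModule) H hHn :=
    hfix2 ▸ Submodule.mem_top
  have h2 := h1 d hd
  rw [← Representation.asModuleEquiv_symm_map_rho] at h2
  exact ρ.asModuleEquiv.symm.injective h2

end RepTransfer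

section BigChar

theorem exists_good_elt {G K : Type} [Group G] [Finite G] [Field K] {M : Subgroup G}
    (hM : IsMinimalNormal M) (hna : ¬ IsAb M) :
    ∃ x ∈ M, x ≠ 1 ∧ ((orderOf x : ℕ) : K) ≠ 0 := by
  by_contra! hcon
  have hbot := hM.2.1
  obtain ⟨y, hy1'⟩ := M.ne_bot_iff_exists_ne_one.mp hbot
  have hy : (y : G) ∈ M := y.2
  have hy1 : (y : G) ≠ 1 := fun h => hy1' (Subtype.ext h)
  have h0 := hcon y hy hy1
  have hp0 : ringChar K ≠ 0 := by
    intro h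
    have h1 := (ringChar.spec K _).mp h0
    rw [h, zero_dvd_iff] at h1
    exact (orderOf_pos (y : G)).ne' h1
  have hp : (ringChar K).Prime := (CharP.char_is_prime_or_zero K (ringChar K)).resolve_right hp0
  have : Fact (ringChar K).Prime := ⟨hp⟩
  have hcard := Nat.eq_prime_pow_of_unique_prime_dvd (n := Nat.card M) (p := ringChar K)
    Nat.card_pos.ne' (by
      intro d hd hdvd
      have : Fact d.Prime := ⟨hd⟩
      obtain ⟨x, hx⟩ := exists_prime_orderOf_dvd_card' (G := M) d hdvd
      have hx' : orderOf (x : G) = d := by rw [Subgroup.orderOf_coe, hx]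
      have h1 := hcon x x.2 (by
        intro h
        rw [h, orderOf_one] at hx'
        exact hd.one_lt.ne hx')
      rw [hx'] at h1
      exact ((Nat.prime_dvd_prime_iff_eq hp hd).mp ((ringChar.spec K _).mp h1)).symm)
  have hpg : IsPGroup (ringChar K) M := IsPGroup.of_card hcard
  have : Nontrivial M := (Subgroup.nontrivial_iff_ne_bot M).mpr hbot
  have hcen := hpg.center_nontrivial
  obtain ⟨z, hz⟩ := exists_ne (1 : Subgroup.center M)
  apply hz
  apply Subtype.ext
  apply Subtype.ext
  refine min_center hM hna (z : M).2 fun w hw => ?_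
  have := Subgroup.mem_center_iff.mp z.2 ⟨w, hw⟩
  exact (congrArg Subtype.val this).symm

theorem extend_char {Q K σ : Type} [CommGroup Q] [Finite Q] [Field K]
    [HasEnoughRootsOfUnity K (Monoid.exponent Q)] (B : Subgroup Q) (χ : B →* Kˣ)
    (T : Finset σ) (m : σ → Q)
    (hm : ∀ s ∈ T, m s ∉ B ⊔ Subgroup.closure (m '' {t | t ∈ T ∧ t ≠ s})) :
    ∃ ψ : Q →* Kˣ, (∀ b : B, ψ b = χ b) ∧ ∀ s ∈ T, ψ (m s) ≠ 1 := by
  classical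
  obtain ⟨ξ, hξ⟩ := MonoidHom.domRestrict_surjective K B χ
  have hφ : ∀ s ∈ T, ∃ φ : Q →* Kˣ, (∀ b ∈ B, φ b = 1) ∧ (∀ t ∈ T, t ≠ s → φ (m t) = 1) ∧
      φ (m s) ≠ 1 := by
    intro s hs
    have h1 := (CommGroup.forall_monoidHom_apply_eq_one_iff K
      (B ⊔ Subgroup.closure (m '' {t | t ∈ T ∧ t ≠ s})) (m s)).not.mpr (hm s hs)
    push Not at h1
    obtain ⟨φ, h2, h3⟩ := h1
    refine ⟨φ, fun b hb => h2 b (Subgroup.mem_sup_left hb), fun t ht hts => h2 _ ?_, h3⟩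
    exact Subgroup.mem_sup_right (Subgroup.subset_closure ⟨t, ⟨ht, hts⟩, rfl⟩)
  choose! φ hφB hφt hφs using hφ
  refine ⟨ξ * ∏ s ∈ T.filter (fun s => ξ (m s) = 1), φ s, ?_, ?_⟩
  · intro b
    rw [MonoidHom.mul_apply, MonoidHom.finsetProd_apply, Finset.prod_eq_one, mul_one, ← hξ]
    · rfl
    · intro s hs
      exact hφB s (Finset.mem_filter.mp hs).1 b b.2
  · intro s hs
    rw [MonoidHom.mul_apply, MonoidHom.finsetProd_apply]
    by_cases h : ξ (m s) = 1
    · rw [h, one_mul, Finset.prod_eq_single s]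
      · exact hφs s hs
      · intro t ht hts
        exact hφt t (Finset.mem_filter.mp ht).1 s hs (Ne.symm hts)
      · intro hn
        exact absurd (Finset.mem_filter.mpr ⟨hs, h⟩) hn
    · rw [Finset.prod_eq_one, mul_one]
      · exact h
      · intro t ht
        refine hφt t (Finset.mem_filter.mp ht).1 s hs ?_
        rintro rfl
        exact h (Finset.mem_filter.mp ht).2

theorem exists_big_char {G K : Type} [Group G] [Finite G] [Field K] [IsAlgClosed K]
    (N : Subgroup G) (hc : ((Nat.card ↥(aSocle G ⊓ N) : ℕ) : K) ≠ 0)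
    (χ : ↥(aSocle G ⊓ N) →* Kˣ) :
    ∃ (Q : Subgroup G) (hB : aSocle G ⊓ N ≤ Q) (_ : IsAb Q) (ψ : Q →* Kˣ),
      (∀ b (hb : b ∈ aSocle G ⊓ N), ψ ⟨b, hB hb⟩ = χ ⟨b, hb⟩) ∧
      ∀ M ∈ nab N, ∃ x, ∃ hx : x ∈ Q, x ∈ M ∧ ψ ⟨x, hx⟩ ≠ 1 := by
  classical
  have hex : ∀ M ∈ nab N, ∃ x ∈ M, x ≠ 1 ∧ ((orderOf x : ℕ) : K) ≠ 0 := fun M hM =>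
    exists_good_elt hM.1.1 hM.1.2
  choose! m hmM hm1 hmo using hex
  have hTfin : (nab N).Finite := Set.toFinite _
  let T := hTfin.toFinset
  have hT : ∀ M, M ∈ T ↔ M ∈ nab N := fun M => hTfin.mem_toFinset
  let S : Set G := (aSocle G ⊓ N : Subgroup G) ∪ m '' nab N
  let Q := Subgroup.closure S
  have hBQ : aSocle G ⊓ N ≤ Q := fun b hb => Subgroup.subset_closure (Or.inl hb)
  have hmQ : ∀ M ∈ nab N, m M ∈ Q := fun M hM => Subgroup.subset_closure (Or.inr ⟨M, hM, rfl⟩)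
  have hScomm : ∀ x ∈ S, ∀ y ∈ S, x * y = y * x := by
    rintro x (hx | ⟨M, hM, rfl⟩) y (hy | ⟨M', hM', rfl⟩)
    · exact aSocle_comm x hx.1 y hy.1
    · exact aSocle_commute hM'.1.1 hx.1 (hmM M' hM')
    · exact (aSocle_commute hM.1.1 hy.1 (hmM M hM)).symm
    · by_cases h : M = M'
      · rw [h]
      · exact min_min_commute hM.1.1 hM'.1.1 h (hmM M hM) (hmM M' hM')
  let instQ : CommGroup Q := Subgroup.closureCommGroupOfComm hScomm
  have hQ : IsAb Q := fun x hx y hy => congrArg Subtype.val (mul_comm (⟨x, hx⟩ : Q) ⟨y, hy⟩)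
  let n := Nat.card ↥(aSocle G ⊓ N) * ∏ M ∈ T, orderOf (m M)
  have hn : ((n : ℕ) : K) ≠ 0 := by
    simp only [n, Nat.cast_mul, Nat.cast_prod]
    refine mul_ne_zero hc (Finset.prod_ne_zero_iff.mpr fun M hM => hmo M ((hT M).mp hM))
  have hpow : ∀ x ∈ Q, x ^ n = 1 := by
    intro x hx
    induction hx using Subgroup.closure_induction with
    | mem x hx =>
      rw [← orderOf_dvd_iff_pow_eq_one]
      rcases hx with hx | ⟨M, hM, rfl⟩
      · refine Dvd.dvd.mul_right ?_ _
        have h1 : orderOf x = orderOf (⟨x, hx⟩ : ↥(aSocle G ⊓ N)) :=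
          (Subgroup.orderOf_mk x hx).symm
        rw [h1]
        exact orderOf_dvd_natCard _
      · exact Dvd.dvd.mul_left (Finset.dvd_prod_of_mem _ ((hT M).mpr hM)) _
    | one => exact one_pow _
    | mul x y hx hy h1 h2 =>
      rw [(show Commute x y from hQ x hx y hy).mul_pow, h1, h2, one_mul]
    | inv x hx h1 => rw [inv_pow, h1, inv_one]
  have hexp : ((Monoid.exponent Q : ℕ) : K) ≠ 0 := by
    have h1 : Monoid.exponent Q ∣ n :=
      Monoid.exponent_dvd_of_forall_pow_eq_one fun x => Subtype.ext (by
        rw [Subgroup.coe_pow]; exact hpow x x.2)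
    obtain ⟨c, hcc⟩ := h1
    intro h
    apply hn
    rw [hcc, Nat.cast_mul, h, zero_mul]
  have hne : NeZero ((Monoid.exponent Q : ℕ) : K) := ⟨hexp⟩
  have hroots : HasEnoughRootsOfUnity K (Monoid.exponent Q) := inferInstance
  let B' : Subgroup Q := (aSocle G ⊓ N).subgroupOf Q
  let mQ : Subgroup G → Q := fun M => if h : M ∈ nab N then ⟨m M, hmQ M h⟩ else 1
  have hmQv : ∀ M ∈ nab N, ((mQ M : Q) : G) = m M := by
    intro M hM
    simp only [mQ, dif_pos hM]
  obtain ⟨ψ, hψ1, hψ2⟩ := extend_char (K := K) B'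
    (χ.comp (Subgroup.subgroupOfEquivOfLe hBQ).toMonoidHom) T mQ (by
      intro M hM hmem
      have hM' := (hT M).mp hM
      have hle : B' ⊔ Subgroup.closure (mQ '' {t | t ∈ T ∧ t ≠ M}) ≤
          (Subgroup.centralizer (M : Set G)).comap Q.subtype := by
        refine sup_le ?_ ((Subgroup.closure_le _).mpr ?_)
        · intro b hb
          have hb' : (b : G) ∈ aSocle G ⊓ N := hb
          rw [Subgroup.mem_comap, Subgroup.mem_centralizer_iff]
          intro y hy
          exact (aSocle_commute hM'.1.1 hb'.1 hy).symm
        · rintro _ ⟨t, ⟨ht, htM⟩, rfl⟩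
          rw [SetLike.mem_coe, Subgroup.mem_comap, Subgroup.mem_centralizer_iff]
          intro y hy
          have ht' := (hT t).mp ht
          change y * (mQ t : G) = (mQ t : G) * y
          rw [hmQv t ht']
          exact (min_min_commute ht'.1.1 hM'.1.1 htM (hmM t ht') hy).symm
      have h1 := hle hmem
      rw [Subgroup.mem_comap, Subgroup.mem_centralizer_iff] at h1
      apply hm1 M hM'
      refine min_center hM'.1.1 hM'.1.2 (hmM M hM') fun y hy => ?_
      have h2 := h1 y hy
      change y * (mQ M : G) = (mQ M : G) * y at h2
      rw [hmQv M hM'] at h2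
      exact h2.symm)
  refine ⟨Q, hBQ, hQ, ψ, ?_, ?_⟩
  · intro b hb
    exact hψ1 ⟨⟨b, hBQ hb⟩, hb⟩
  · intro M hM
    refine ⟨m M, hmQ M hM, hmM M hM, ?_⟩
    have h1 := hψ2 M ((hT M).mpr hM)
    have h2 : mQ M = ⟨m M, hmQ M hM⟩ := Subtype.ext (hmQv M hM)
    rw [h2] at h1
    exact h1

end BigChar
/-- Let `G` be a finite group, `N ⊴ G`, `F` an arbitrary field whose characteristic does
not divide `|A(G) ∩ N|`, and `k ≥ 1`.  Then `S(G) ∩ N` is `k`-generated as a normal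
subgroup of `G` if and only if there is an `F[G]`-module which is a direct sum of `k`
simple `F[G]`-modules and whose restriction to `N` is faithful. -/
theorem relative_zmud (G : Type) [Group G] [Finite G] (N : Subgroup G)
    (hN : N.Normal) (F : Type) [Field F]
    (hchar : ¬ (ringChar F ∣ Nat.card ↥(aSocle G ⊓ N))) (k : ℕ) (hk : 1 ≤ k) :
    NormallyKGenerated (socle G ⊓ N) k ↔
      (∃ (n : ℕ) (ρ : Representation F G (Fin n → F)),
        (∀ g ∈ N, (∀ v : Fin n → F, ρ g v = v) → g = 1) ∧
        ∃ W : Fin k → Submodule (MonoidAlgebra F G) ρ.asModule,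
          (∀ i, IsSimpleModule (MonoidAlgebra F G) ↥(W i)) ∧
          DirectSum.IsInternal W) := by
  let K := AlgebraicClosure F
  have hcF : ((Nat.card ↥(aSocle G ⊓ N) : ℕ) : F) ≠ 0 := fun h =>
    hchar ((ringChar.spec F _).mp h)
  have hcK : ((Nat.card ↥(aSocle G ⊓ N) : ℕ) : K) ≠ 0 := by
    intro h
    apply hcF
    apply (algebraMap F K).injective
    rw [map_natCast, h, map_zero]
  have hBab : IsAb (aSocle G ⊓ N) := fun x hx y hy => aSocle_comm x hx.1 y hy.1
  rw [kgen_iff N hN k hk, kgen_iff_chars N hN k K hcK]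
  constructor
  · rintro ⟨χ, hχ⟩
    have hmax : ∀ (Q : Subgroup G) (_ : IsAb Q) (ψ : Q →* Kˣ),
        ∃ m : Submodule (MonoidAlgebra F G) (MonoidAlgebra F G), IsCoatom m ∧
          ∀ q : Q, MonoidAlgebra.of F G (q : G) - 1 ∈ m → ψ q = 1 := by
      intro Q hQ ψ
      let : CommGroup Q :=
        { (inferInstance : Group Q) with
          mul_comm := fun a b => Subtype.ext (hQ a a.2 b b.2) }
      exact exists_maximal_left (F := F) (K := K) Q.subtype Subtype.val_injective ψ
    obtain ⟨Q, hBQ, hQ, ψ, hψB, hψM⟩ := exists_big_char N hcK (χ ⟨0, hk⟩)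
    obtain ⟨m0, hm0, hm0'⟩ := hmax Q hQ ψ
    have hmi := fun i => hmax (aSocle G ⊓ N) hBab (χ i)
    choose m hm hm' using hmi
    let μ : Fin k → Submodule (MonoidAlgebra F G) (MonoidAlgebra F G) :=
      fun i => if i = ⟨0, hk⟩ then m0 else m i
    have hμ0 : μ ⟨0, hk⟩ = m0 := if_pos rfl
    have hμ : ∀ i, i ≠ ⟨0, hk⟩ → μ i = m i := fun i hi => if_neg hi
    obtain ⟨n, ρ, hρ, hW⟩ := exists_rep k μ (by
      intro i
      by_cases hi : i = ⟨0, hk⟩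
      · rw [hi, hμ0]; exact hm0
      · rw [hμ i hi]; exact hm i)
    refine ⟨n, ρ, ?_, hW⟩
    have htriv : ∀ g, ρ g = 1 → ∀ i, MonoidAlgebra.of F G g - 1 ∈ μ i := by
      intro g hg i
      have h1 := hρ g (fun v => by rw [hg]; rfl) i 1
      rwa [mul_one] at h1
    let D : Subgroup G := MonoidHom.ker ρ ⊓ N
    have hDn : D.Normal := inferInstance
    have hDbot : D = ⊥ := by
      by_contra hne
      obtain ⟨M, ⟨hMn, hMb, hMD⟩, hMmin⟩ := Set.Finite.exists_minimal
        (s := {M : Subgroup G | M.Normal ∧ M ≠ ⊥ ∧ M ≤ D}) (Set.toFinite _)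
        ⟨D, hDn, hne, le_rfl⟩
      have hM : IsMinimalNormal M := ⟨hMn, hMb, fun L hL hLb hLM =>
        le_antisymm hLM (hMmin ⟨hL, hLb, hLM.trans hMD⟩ hLM)⟩
      have hMtriv : ∀ x ∈ M, ∀ i, MonoidAlgebra.of F G x - 1 ∈ μ i := fun x hx =>
        htriv x (hMD hx).1
      have hMN : M ≤ N := hMD.trans inf_le_right
      by_cases hab : IsAb M
      · have hMA : M ≤ aSocle G := le_sSup (a := M) (s := {M : Subgroup G | IsMinimalNormal M ∧
          ∀ x ∈ M, ∀ y ∈ M, x * y = y * x}) ⟨hM, hab⟩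
        have hMB : M ≤ aSocle G ⊓ N := le_inf hMA hMN
        apply hMb
        refine hχ M hMn hMB fun i h hh => ?_
        have h1 := hMtriv h hh i
        by_cases hi : i = ⟨0, hk⟩
        · rw [hi, hμ0] at h1
          rw [hi, ← hψB]
          exact hm0' ⟨h, hBQ (hMB hh)⟩ h1
        · rw [hμ i hi] at h1
          exact hm' i ⟨h, hMB hh⟩ h1
      · obtain ⟨x, hxQ, hxM, hx⟩ := hψM M ⟨⟨hM, hab⟩, hMN⟩
        apply hx
        have h1 := hMtriv x hxM ⟨0, hk⟩
        rw [hμ0] at h1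
        exact hm0' ⟨x, hxQ⟩ h1
    intro g hg hv
    have h1 : g ∈ D := ⟨MonoidHom.mem_ker.mpr (LinearMap.ext hv), hg⟩
    rw [hDbot] at h1
    exact h1
  · rintro ⟨n, ρ, hf, W, hW, hInternal⟩
    exact chars_of_rep N (aSocle G ⊓ N) inf_le_right hBab F K k n ρ hf W hW hInternal
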